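/- arXiv:1905.07544 — 2 statements merged into one kernel-verified Lean document; each statement's English description precedes it below -/
import Mathlib

section
/- Let K > 0, c₂ ≥ 0, c₃ ∈ ℝ. Then the function r(u) = (K − c₂·q(u))/u + c₃ is strictly quasi-convex on (0,∞): for all 0 < u₁ < u₂ < u₃, r(u₂) < max(r(u₁), r(u₃)). (This is the form taken, when the other state earns weakly more, by the sign-function of the endpoint derivative of the dynamic-model reward under positive affine pricing w_i(τ) = m·τ + a with m, a > 0.) -/
open Set

/-- `q(s)`: the probability that a two-state CTMC with rate `α` from state i to j and
rate `β` from j to i, started in state i, is in state j after time `s`. -/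
noncomputable def qfun (α β s : ℝ) : ℝ := α / (α + β) * (1 - Real.exp (-(α + β) * s))

/-- If `f` is strictly convex on `(0,∞)`, then `u ↦ f u / u` is strictly quasi-convex there. -/
theorem StrictConvexOn.div_id_lt_max {f : ℝ → ℝ} (hf : StrictConvexOn ℝ (Ioi 0) f)
    {x y z : ℝ} (hx : 0 < x) (hxy : x < y) (hyz : y < z) :
    f y / y < max (f x / x) (f z / z) := by
  have hy : 0 < y := hx.trans hxy
  have hz : 0 < z := hy.trans hyz
  by_contra! h
  obtain ⟨h₁, h₃⟩ := max_le_iff.mp h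
  rw [div_le_iff₀ hx] at h₁
  rw [div_le_iff₀ hz] at h₃
  have hslope := hf.slope_strict_mono_adjacent (mem_Ioi.mpr hx) (mem_Ioi.mpr hz) hxy hyz
  rw [div_lt_div_iff₀ (sub_pos.mpr hxy) (sub_pos.mpr hyz)] at hslope
  have hfy : f y = f y / y * y := (div_mul_cancel₀ _ hy.ne').symm
  set t := f y / y
  rw [hfy] at hslope
  nlinarith [mul_le_mul_of_nonneg_right h₁ (sub_pos.mpr hyz).le,
    mul_le_mul_of_nonneg_right h₃ (sub_pos.mpr hxy).le]

theorem strictConvexOn_sub_mul_qfun {α β : ℝ} (hα : 0 < α) (hβ : 0 < β) (K : ℝ) {c : ℝ}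
    (hc : 0 < c) : StrictConvexOn ℝ (Ioi 0) fun u => K - c * qfun α β u := by
  refine ⟨convex_Ioi 0, fun x _ y _ hxy a b ha hb hab => ?_⟩
  have hs : 0 < α + β := add_pos hα hβ
  have hne : -(α + β) * x ≠ -(α + β) * y := fun h =>
    hxy (mul_left_cancel₀ (neg_ne_zero.mpr hs.ne') h)
  have hexp := strictConvexOn_exp.2 (mem_univ _) (mem_univ _) hne ha hb hab
  simp only [smul_eq_mul, qfun] at hexp ⊢
  rw [show a * (-(α + β) * x) + b * (-(α + β) * y) = -(α + β) * (a * x + b * y) by ring]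
    at hexp
  have hmul := mul_lt_mul_of_pos_left hexp (mul_pos hc (div_pos hα hs))
  obtain rfl : b = 1 - a := by linarith
  linarith

/-- For `K > 0`, `c₂ ≥ 0`, `c₃ ∈ ℝ`, the function `r(u) = (K − c₂·q(u))/u + c₃` is
strictly quasi-convex on `(0,∞)`. -/
theorem endpoint_sign_function_strict_quasiconvex
    (α β : ℝ) (hα : 0 < α) (hβ : 0 < β)
    (K : ℝ) (hK : 0 < K) (c₂ : ℝ) (hc₂ : 0 ≤ c₂) (c₃ : ℝ) :
    ∀ u₁ u₂ u₃ : ℝ, 0 < u₁ → u₁ < u₂ → u₂ < u₃ →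
      (K - c₂ * qfun α β u₂) / u₂ + c₃ <
        max ((K - c₂ * qfun α β u₁) / u₁ + c₃) ((K - c₂ * qfun α β u₃) / u₃ + c₃) := by
  intro u₁ u₂ u₃ h₁ h₁₂ h₂₃
  rw [max_add_add_right]
  gcongr
  rcases hc₂.eq_or_lt with rfl | hc
  · refine lt_max_of_lt_left ?_
    simpa using div_lt_div_of_pos_left hK h₁ h₁₂
  · exact (strictConvexOn_sub_mul_qfun hα hβ K hc).div_id_lt_max h₁ h₁₂ h₂₃
end

section
/- Let K > 0, c₂ ≥ 0, c₃ ∈ ℝ. Then the function r(u) = (c₂·q(u) − K)/u + c₃ is strictly quasi-concave on (0,∞): for all 0 < u₁ < u₂ < u₃, r(u₂) > min(r(u₁), r(u₃)). (This is the form taken, when the other state earns weakly less, by the sign-function of the endpoint derivative of the dynamic-model reward under negative affine pricing w_i(τ) = m·τ − a with m, a > 0.) -/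
open Set

theorem strictConcaveOn_qfun {α β : ℝ} (hα : 0 < α) (hβ : 0 < β) :
    StrictConcaveOn ℝ univ (qfun α β) := by
  refine ⟨convex_univ, fun x _ y _ hxy a b ha hb hab => ?_⟩
  have hγ : 0 < α + β := by positivity
  have hne : -(α + β) * x ≠ -(α + β) * y := fun h =>
    hxy (mul_left_cancel₀ (neg_ne_zero.mpr hγ.ne') h)
  have hexp := strictConvexOn_exp.2 (mem_univ _) (mem_univ _) hne ha hb hab
  simp only [smul_eq_mul] at hexp
  have harg : -(α + β) * (a * x + b * y) =
      a * (-(α + β) * x) + b * (-(α + β) * y) := by ring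
  have hq := mul_lt_mul_of_pos_left hexp (div_pos hα hγ)
  simp only [qfun, smul_eq_mul]
  rw [harg]
  linear_combination hq + α / (α + β) * hab

/-- The ratio of a strictly concave function to the identity is strictly quasi-concave on
the positive half-line. -/
theorem StrictConcaveOn.min_div_lt_div {f : ℝ → ℝ} (hf : StrictConcaveOn ℝ (Ioi 0) f)
    {x y z : ℝ} (hx : 0 < x) (hxy : x < y) (hyz : y < z) :
    min (f x / x) (f z / z) < f y / y := by
  have hy : 0 < y := hx.trans hxy
  have hz : 0 < z := hy.trans hyz
  by_contra! h
  obtain ⟨hfx, hfz⟩ := le_min_iff.mp h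
  rw [le_div_iff₀ hx] at hfx
  rw [le_div_iff₀ hz] at hfz
  have hfy : f y / y * y = f y := div_mul_cancel₀ _ hy.ne'
  have hslope := hf.slope_anti_adjacent hx hz hxy hyz
  have hright : f y / y ≤ (f z - f y) / (z - y) := by
    rw [le_div_iff₀ (sub_pos.mpr hyz)]
    linarith
  have hleft : (f y - f x) / (y - x) ≤ f y / y := by
    rw [div_le_iff₀ (sub_pos.mpr hxy)]
    linarith
  exact (hright.trans_lt hslope).not_ge hleft

/-- For `K > 0`, `c₂ ≥ 0`, `c₃ ∈ ℝ`, the function `r(u) = (c₂·q(u) − K)/u + c₃` is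
strictly quasi-concave on `(0,∞)`. -/
theorem endpoint_sign_function_strict_quasiconcave
    (α β : ℝ) (hα : 0 < α) (hβ : 0 < β)
    (K : ℝ) (hK : 0 < K) (c₂ : ℝ) (hc₂ : 0 ≤ c₂) (c₃ : ℝ) :
    ∀ u₁ u₂ u₃ : ℝ, 0 < u₁ → u₁ < u₂ → u₂ < u₃ →
      min ((c₂ * qfun α β u₁ - K) / u₁ + c₃) ((c₂ * qfun α β u₃ - K) / u₃ + c₃) <
        (c₂ * qfun α β u₂ - K) / u₂ + c₃ := by
  intro u₁ u₂ u₃ h₁ h₁₂ h₂₃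
  rw [min_add_add_right, add_lt_add_iff_right]
  rcases hc₂.eq_or_lt with rfl | hc
  · refine (min_le_left _ _).trans_lt ?_
    simp only [zero_mul, zero_sub, neg_div, neg_lt_neg_iff]
    exact div_lt_div_of_pos_left hK h₁ h₁₂
  · have hf : StrictConcaveOn ℝ (Ioi 0) fun u => c₂ * qfun α β u - K := by
      refine ⟨convex_Ioi 0, fun x _ y _ hxy a b ha hb hab => ?_⟩
      have hq := mul_lt_mul_of_pos_left
        ((strictConcaveOn_qfun hα hβ).2 (mem_univ x) (mem_univ y) hxy ha hb hab) hc
      simp only [smul_eq_mul] at hq ⊢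
      linear_combination hq - K * hab
    exact hf.min_div_lt_div h₁ h₁₂ h₂₃
end
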